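/- Let H = N⋊T be the smash product of cocommutative Hopf algebras N and T over a field k, and let the commutative k-algebra A be a trivial H-module. Then every Sweedler 2-cocycle f: H⊗H → A is cohomologous to a Sweedler 2-cocycle f': H⊗H → A that is trivial on N⊗T, i.e. f'(n⊗t) = ε(n)ε(t)1_A for all n ∈ N and t ∈ T (identifying n = n⋊1 and t = 1⋊t). -/

import Mathlib

open TensorProduct

namespace SmashPaper

variable (k : Type) [Field k]

section Conv

variable {k : Type} [Field k] {C A : Type} [AddCommGroup C] [Module k C] [Coalgebra k C]
  [CommRing A] [Algebra k A]

/-- Convolution product on linear maps from a coalgebra to an algebra. -/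
noncomputable def conv (f g : C →ₗ[k] A) : C →ₗ[k] A :=
  LinearMap.mul' k A ∘ₗ TensorProduct.map f g ∘ₗ Coalgebra.comul

/-- Convolution unit. -/
noncomputable def convOne (C A : Type) [AddCommGroup C] [Module k C] [Coalgebra k C]
    [CommRing A] [Algebra k A] : C →ₗ[k] A :=
  Algebra.linearMap k A ∘ₗ Coalgebra.counit

def IsConvInv (f g : C →ₗ[k] A) : Prop :=
  conv f g = convOne C A ∧ conv g f = convOne C A

def IsConvInvertible (f : C →ₗ[k] A) : Prop := ∃ g, IsConvInv f g

end Conv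

/-- Cocommutativity of a coalgebra. -/
def IsCocomm (C : Type) [AddCommGroup C] [Module k C] [Coalgebra k C] : Prop :=
  (TensorProduct.comm k C C).toLinearMap ∘ₗ Coalgebra.comul
    = (Coalgebra.comul : C →ₗ[k] C ⊗[k] C)

section Drop

variable {k : Type} [Field k] (C D : Type) [AddCommGroup C] [Module k C]
  [AddCommGroup D] [Module k D]

/-- `c ⊗ d ↦ ε(c) d`. -/
noncomputable def dropL [Coalgebra k C] : C ⊗[k] D →ₗ[k] D :=
  (TensorProduct.lid k D).toLinearMap ∘ₗ LinearMap.rTensor D (Coalgebra.counit (R := k))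

/-- `c ⊗ d ↦ ε(d) c`. -/
noncomputable def dropR [Coalgebra k D] : C ⊗[k] D →ₗ[k] C :=
  (TensorProduct.rid k C).toLinearMap ∘ₗ LinearMap.lTensor C (Coalgebra.counit (R := k))

end Drop

section Sweedler

variable {k : Type} [Field k] (H A : Type) [Ring H] [Bialgebra k H]
  [CommRing A] [Algebra k A]

variable {H A}

/-- Normalization for 1-cochains. -/
def Normalized1 (t : H →ₗ[k] A) : Prop := t 1 = 1

/-- Normalization for 2-cochains: trivial whenever an argument is a scalar. -/
def Normalized2 (f : H ⊗[k] H →ₗ[k] A) : Prop :=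
  ∀ x : H, f (1 ⊗ₜ[k] x) = algebraMap k A (Coalgebra.counit x)
    ∧ f (x ⊗ₜ[k] 1) = algebraMap k A (Coalgebra.counit x)

/-- Normalization for 3-cochains. -/
def Normalized3 (f : (H ⊗[k] H) ⊗[k] H →ₗ[k] A) : Prop :=
  ∀ x y : H,
    f ((1 ⊗ₜ[k] x) ⊗ₜ[k] y) = algebraMap k A (Coalgebra.counit x * Coalgebra.counit y)
    ∧ f ((x ⊗ₜ[k] 1) ⊗ₜ[k] y) = algebraMap k A (Coalgebra.counit x * Coalgebra.counit y)
    ∧ f ((x ⊗ₜ[k] y) ⊗ₜ[k] 1) = algebraMap k A (Coalgebra.counit x * Coalgebra.counit y)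

/-- `∑ f(x₍₁₎ ⊗ y₍₁₎) f(x₍₂₎y₍₂₎ ⊗ z)` as a linear map on `(H ⊗ H) ⊗ H`. -/
noncomputable def cocycle2LHS (f : H ⊗[k] H →ₗ[k] A) : (H ⊗[k] H) ⊗[k] H →ₗ[k] A :=
  conv (f ∘ₗ dropR (H ⊗[k] H) H) (f ∘ₗ LinearMap.rTensor H (LinearMap.mul' k H))

/-- `∑ f(y₍₁₎ ⊗ z₍₁₎) f(x ⊗ y₍₂₎z₍₂₎)` as a linear map on `(H ⊗ H) ⊗ H`. -/
noncomputable def cocycle2RHS (f : H ⊗[k] H →ₗ[k] A) : (H ⊗[k] H) ⊗[k] H →ₗ[k] A :=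
  conv (f ∘ₗ dropL H (H ⊗[k] H) ∘ₗ (TensorProduct.assoc k H H H).toLinearMap)
       (f ∘ₗ LinearMap.lTensor H (LinearMap.mul' k H) ∘ₗ (TensorProduct.assoc k H H H).toLinearMap)

/-- Sweedler 2-cocycles (for the trivial action). -/
def IsZ2 (f : H ⊗[k] H →ₗ[k] A) : Prop :=
  Normalized2 f ∧ IsConvInvertible f ∧ cocycle2LHS f = cocycle2RHS f

/-- The Sweedler 2-coboundary `∑ t(y₍₁₎) t⁻¹(x₍₁₎y₍₂₎) t(x₍₂₎)` of a 1-cochain `t`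
with convolution inverse `tinv`. -/
noncomputable def cobound2 (t tinv : H →ₗ[k] A) : H ⊗[k] H →ₗ[k] A :=
  conv (t ∘ₗ dropL H H) (conv (tinv ∘ₗ LinearMap.mul' k H) (t ∘ₗ dropR H H))

/-- Sweedler 2-coboundaries (for the trivial action). -/
def IsB2 (f : H ⊗[k] H →ₗ[k] A) : Prop :=
  ∃ t tinv : H →ₗ[k] A, Normalized1 t ∧ IsConvInv t tinv ∧ f = cobound2 t tinv

/-- Two 2-cochains are cohomologous when they differ (in convolution) by a 2-coboundary. -/
def Cohomologous2 (f f' : H ⊗[k] H →ₗ[k] A) : Prop :=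
  ∃ b, IsB2 b ∧ f = conv f' b

/-- `(x⊗y)⊗z ↦ x ⊗ yz`. -/
noncomputable def m23 : (H ⊗[k] H) ⊗[k] H →ₗ[k] H ⊗[k] H :=
  LinearMap.lTensor H (LinearMap.mul' k H) ∘ₗ (TensorProduct.assoc k H H H).toLinearMap

/-- `(x⊗y)⊗z ↦ ε(x) (y⊗z)`. -/
noncomputable def p23 : (H ⊗[k] H) ⊗[k] H →ₗ[k] H ⊗[k] H :=
  dropL H (H ⊗[k] H) ∘ₗ (TensorProduct.assoc k H H H).toLinearMap

/-- 3-cocycle condition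
`∑ f(y₁⊗z₁⊗w₁) f(x₁⊗y₂z₂⊗w₂) f(x₂⊗y₃⊗z₃) = ∑ f(x₁y₁⊗z₁⊗w₁) f(x₂⊗y₂⊗z₂w₂)`. -/
def IsZ3cond (f : (H ⊗[k] H) ⊗[k] H →ₗ[k] A) : Prop :=
  conv (f ∘ₗ LinearMap.rTensor H (LinearMap.rTensor H (dropL H H)))
    (conv (f ∘ₗ LinearMap.rTensor H (m23 (H := H)))
          (f ∘ₗ dropR ((H ⊗[k] H) ⊗[k] H) H))
  = conv (C := ((H ⊗[k] H) ⊗[k] H) ⊗[k] H)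
         (f ∘ₗ LinearMap.rTensor H (LinearMap.rTensor H (LinearMap.mul' k H)))
         (f ∘ₗ (LinearMap.lTensor (H ⊗[k] H) (LinearMap.mul' k H)
              ∘ₗ (TensorProduct.assoc k (H ⊗[k] H) H H).toLinearMap :
                ((H ⊗[k] H) ⊗[k] H) ⊗[k] H →ₗ[k] (H ⊗[k] H) ⊗[k] H))

/-- Sweedler 3-cocycles (for the trivial action). -/
def IsZ3 (f : (H ⊗[k] H) ⊗[k] H →ₗ[k] A) : Prop :=
  Normalized3 f ∧ IsConvInvertible f ∧ IsZ3cond f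

/-- The Sweedler 3-coboundary
`∑ v(y₁⊗z₁) v⁻¹(x₁y₂⊗z₂) v(x₂⊗y₃z₃) v⁻¹(x₃⊗y₄)` of a 2-cochain `v`. -/
noncomputable def cobound3 (v vinv : H ⊗[k] H →ₗ[k] A) : (H ⊗[k] H) ⊗[k] H →ₗ[k] A :=
  conv (v ∘ₗ p23 (H := H))
    (conv (vinv ∘ₗ LinearMap.rTensor H (LinearMap.mul' k H))
      (conv (v ∘ₗ m23 (H := H)) (vinv ∘ₗ dropR (H ⊗[k] H) H)))

/-- Sweedler 3-coboundaries (for the trivial action). -/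
def IsB3 (f : (H ⊗[k] H) ⊗[k] H →ₗ[k] A) : Prop :=
  ∃ v vinv : H ⊗[k] H →ₗ[k] A, Normalized2 v ∧ IsConvInv v vinv ∧ f = cobound3 v vinv

/-- Cohomologous 3-cochains. -/
def Cohomologous3 (f f' : (H ⊗[k] H) ⊗[k] H →ₗ[k] A) : Prop :=
  ∃ b, IsB3 b ∧ f = conv f' b

end Sweedler

section Measuring

variable {k : Type} [Field k]
variable {C : Type} [AddCommGroup C] [Module k C] [Coalgebra k C]
variable {N : Type} [Ring N] [Bialgebra k N]
variable {A : Type} [CommRing A] [Algebra k A]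

/-- `(C, θ)` measures `N` to `A`:
`∑ θ(c₍₁₎ ⊗ n) θ(c₍₂₎ ⊗ n') = θ(c ⊗ nn')` and `θ(c ⊗ 1) = ε(c) 1`. -/
def Measures (θ : C ⊗[k] N →ₗ[k] A) : Prop :=
  (θ ∘ₗ LinearMap.lTensor C (LinearMap.mul' k N)
    = conv (θ ∘ₗ LinearMap.lTensor C (dropR N N)) (θ ∘ₗ LinearMap.lTensor C (dropL N N)))
  ∧ ∀ c : C, θ (c ⊗ₜ[k] (1 : N)) = algebraMap k A (Coalgebra.counit c)

end Measuring

section Action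

variable {k : Type} [Field k]
variable {T N : Type} [Ring T] [Bialgebra k T] [Ring N] [Bialgebra k N]

/-- `μ : T ⊗ N → N` makes `N` a left `T`-module bialgebra. -/
structure IsModuleBialgebra (μ : T ⊗[k] N →ₗ[k] N) : Prop where
  one_act : ∀ n : N, μ ((1 : T) ⊗ₜ[k] n) = n
  mul_act : ∀ (t s : T) (n : N), μ ((t * s) ⊗ₜ[k] n) = μ (t ⊗ₜ[k] μ (s ⊗ₜ[k] n))
  act_one : ∀ t : T, μ (t ⊗ₜ[k] (1 : N)) = algebraMap k N (Coalgebra.counit t)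
  act_mul : μ ∘ₗ LinearMap.lTensor T (LinearMap.mul' k N)
      = LinearMap.mul' k N ∘ₗ TensorProduct.map μ μ
          ∘ₗ (TensorProduct.tensorTensorTensorComm k T T N N).toLinearMap
          ∘ₗ LinearMap.rTensor (N ⊗[k] N) Coalgebra.comul
  comul_act : Coalgebra.comul ∘ₗ μ
      = TensorProduct.map μ μ
          ∘ₗ (TensorProduct.tensorTensorTensorComm k T T N N).toLinearMap
          ∘ₗ TensorProduct.map Coalgebra.comul Coalgebra.comul
  counit_act : ∀ (t : T) (n : N),
      Coalgebra.counit (R := k) (μ (t ⊗ₜ[k] n))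
        = Coalgebra.counit (R := k) t * Coalgebra.counit (R := k) n

/-- `t ⊗ n ↦ ∑ t₍₁₎(n) ⊗ t₍₂₎`. -/
noncomputable def smashCross (μ : T ⊗[k] N →ₗ[k] N) : T ⊗[k] N →ₗ[k] N ⊗[k] T :=
  TensorProduct.map μ LinearMap.id
    ∘ₗ (TensorProduct.assoc k T N T).symm.toLinearMap
    ∘ₗ LinearMap.lTensor T (TensorProduct.comm k T N).toLinearMap
    ∘ₗ (TensorProduct.assoc k T T N).toLinearMap
    ∘ₗ LinearMap.rTensor N Coalgebra.comul

variable {H : Type} [Ring H] [Bialgebra k H]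

/-- `H` is the smash product `N ⋊ T` along the action `μ`, with `N` and `T` included
as the Hopf subalgebras `N ⋊ 1` and `1 ⋊ T`; we identify `n ⋊ t = n t`. -/
structure IsSmashProduct (μ : T ⊗[k] N →ₗ[k] N) (iN : N →ₐc[k] H) (iT : T →ₐc[k] H) : Prop where
  act : IsModuleBialgebra μ
  injN : Function.Injective iN
  injT : Function.Injective iT
  /-- `n ⊗ t ↦ (n ⋊ 1)(1 ⋊ t)` is a linear isomorphism `N ⊗ T ≅ H` (`H` is the
  tensor product coalgebra `N ⊗ T`). -/
  bij : Function.Bijective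
    (LinearMap.mul' k H ∘ₗ TensorProduct.map (iN : N →ₗ[k] H) (iT : T →ₗ[k] H))
  /-- The smash relation `t n = ∑ t₍₁₎(n) t₍₂₎` in `H`. -/
  straighten : LinearMap.mul' k H ∘ₗ TensorProduct.map (iT : T →ₗ[k] H) (iN : N →ₗ[k] H)
      = LinearMap.mul' k H ∘ₗ TensorProduct.map (iN : N →ₗ[k] H) (iT : T →ₗ[k] H)
          ∘ₗ smashCross μ

end Action

section MeasCohomology

variable {k : Type} [Field k]
variable {T N : Type} [Ring T] [Bialgebra k T] [Ring N] [Bialgebra k N]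
variable {A : Type} [CommRing A] [Algebra k A]

/-- Normalization in the `T`-variable for measuring 1-cochains `T ⊗ N → A`. -/
def MeasNormalized1 (f : T ⊗[k] N →ₗ[k] A) : Prop :=
  ∀ n : N, f ((1 : T) ⊗ₜ[k] n) = algebraMap k A (Coalgebra.counit n)

/-- A measuring 1-cochain: an element of `Reg_meas(T, Hom(N,A))`. -/
def IsRegMeas1 (f : T ⊗[k] N →ₗ[k] A) : Prop :=
  Measures f ∧ MeasNormalized1 f ∧ IsConvInvertible f

/-- The measuring 1-cocycle condition `f(ts)(n) = ∑ f(s₍₁₎)(n₍₁₎) f(t)(s₍₂₎(n₍₂₎))`. -/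
def MeasCocycle1 (μ : T ⊗[k] N →ₗ[k] N) (f : T ⊗[k] N →ₗ[k] A) : Prop :=
  f ∘ₗ LinearMap.rTensor N (LinearMap.mul' k T)
    = conv (f ∘ₗ LinearMap.rTensor N (dropL T T))
      (f ∘ₗ LinearMap.lTensor T μ ∘ₗ (TensorProduct.assoc k T T N).toLinearMap)

/-- Measuring 1-cocycles. -/
def IsMeasZ1 (μ : T ⊗[k] N →ₗ[k] N) (f : T ⊗[k] N →ₗ[k] A) : Prop :=
  IsRegMeas1 f ∧ MeasCocycle1 μ f

/-- Measuring 1-coboundaries: `f(t)(n) = ∑ g(n₍₁₎) g⁻¹(t(n₍₂₎))` for a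
convolution-invertible algebra map `g : N → A`. -/
def IsMeasB1 (μ : T ⊗[k] N →ₗ[k] N) (f : T ⊗[k] N →ₗ[k] A) : Prop :=
  ∃ (g : N →ₐ[k] A) (ginv : N →ₗ[k] A), IsConvInv g.toLinearMap ginv ∧
    f = conv (g.toLinearMap ∘ₗ dropL T N) (ginv ∘ₗ μ)

/-- Normalization for measuring 2-cochains `(T ⊗ T) ⊗ N → A`. -/
def MeasNormalized2 (f : (T ⊗[k] T) ⊗[k] N →ₗ[k] A) : Prop :=
  ∀ (t : T) (n : N),
    f (((1 : T) ⊗ₜ[k] t) ⊗ₜ[k] n)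
        = algebraMap k A (Coalgebra.counit t * Coalgebra.counit n)
    ∧ f ((t ⊗ₜ[k] (1 : T)) ⊗ₜ[k] n)
        = algebraMap k A (Coalgebra.counit t * Coalgebra.counit n)

/-- A measuring 2-cochain: an element of `Reg_meas(T ⊗ T, Hom(N,A))`. -/
def IsRegMeas2 (f : (T ⊗[k] T) ⊗[k] N →ₗ[k] A) : Prop :=
  Measures f ∧ MeasNormalized2 f ∧ IsConvInvertible f

/-- The measuring 2-cocycle condition
`∑ f(t₍₁₎⊗s₍₁₎)(r₍₁₎(n₍₁₎)) f(t₍₂₎s₍₂₎⊗r₍₂₎)(n₍₂₎) = ∑ f(s₍₁₎⊗r₍₁₎)(n₍₁₎) f(t⊗s₍₂₎r₍₂₎)(n₍₂₎)`. -/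
def MeasCocycle2 (μ : T ⊗[k] N →ₗ[k] N) (f : (T ⊗[k] T) ⊗[k] N →ₗ[k] A) : Prop :=
  conv (C := ((T ⊗[k] T) ⊗[k] T) ⊗[k] N)
       (f ∘ₗ (LinearMap.lTensor (T ⊗[k] T) μ
          ∘ₗ (TensorProduct.assoc k (T ⊗[k] T) T N).toLinearMap :
            ((T ⊗[k] T) ⊗[k] T) ⊗[k] N →ₗ[k] (T ⊗[k] T) ⊗[k] N))
       (f ∘ₗ LinearMap.rTensor N (LinearMap.rTensor T (LinearMap.mul' k T)))
    = conv (C := ((T ⊗[k] T) ⊗[k] T) ⊗[k] N)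
           (f ∘ₗ LinearMap.rTensor N (LinearMap.rTensor T (dropL T T)))
           (f ∘ₗ LinearMap.rTensor N
              ((LinearMap.lTensor T (LinearMap.mul' k T)
                ∘ₗ (TensorProduct.assoc k T T T).toLinearMap :
                  (T ⊗[k] T) ⊗[k] T →ₗ[k] T ⊗[k] T)))

/-- Measuring 2-cocycles. -/
def IsMeasZ2 (μ : T ⊗[k] N →ₗ[k] N) (f : (T ⊗[k] T) ⊗[k] N →ₗ[k] A) : Prop :=
  IsRegMeas2 f ∧ MeasCocycle2 μ f

/-- The measuring coboundary
`(t ⊗ s ⊗ n) ↦ ∑ g(s₍₁₎)(n₍₁₎) g⁻¹(t₍₁₎s₍₂₎)(n₍₂₎) g(t₍₂₎)(s₍₃₎(n₍₃₎))`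
of a 1-cochain `g` with convolution inverse `ginv`.  (For a 2-cocycle `f` on `N` with
stability witness `g`, this same formula is the map `d`. ) -/
noncomputable def measCobound (μ : T ⊗[k] N →ₗ[k] N) (g ginv : T ⊗[k] N →ₗ[k] A) :
    (T ⊗[k] T) ⊗[k] N →ₗ[k] A :=
  conv (g ∘ₗ LinearMap.rTensor N (dropL T T))
    (conv (ginv ∘ₗ LinearMap.rTensor N (LinearMap.mul' k T))
          (g ∘ₗ LinearMap.lTensor T μ ∘ₗ (TensorProduct.assoc k T T N).toLinearMap))

/-- Measuring 2-coboundaries. -/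
def IsMeasB2 (μ : T ⊗[k] N →ₗ[k] N) (f : (T ⊗[k] T) ⊗[k] N →ₗ[k] A) : Prop :=
  ∃ g ginv : T ⊗[k] N →ₗ[k] A, IsRegMeas1 g ∧ IsConvInv g ginv ∧ f = measCobound μ g ginv

/-- Cohomologous measuring 2-cochains. -/
def MeasCohomologous2 (μ : T ⊗[k] N →ₗ[k] N) (f f' : (T ⊗[k] T) ⊗[k] N →ₗ[k] A) : Prop :=
  ∃ b, IsMeasB2 μ b ∧ f = conv f' b

/-- `∑ f(n₍₁₎ ⊗ n'₍₁₎) f⁻¹(t₍₁₎(n₍₂₎) ⊗ t₍₂₎(n'₍₂₎))` as a map `T ⊗ (N ⊗ N) → A`. -/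
noncomputable def stabLHS (μ : T ⊗[k] N →ₗ[k] N) (f finv : N ⊗[k] N →ₗ[k] A) :
    T ⊗[k] (N ⊗[k] N) →ₗ[k] A :=
  conv (f ∘ₗ dropL T (N ⊗[k] N))
       (finv ∘ₗ TensorProduct.map μ μ
          ∘ₗ (TensorProduct.tensorTensorTensorComm k T T N N).toLinearMap
          ∘ₗ LinearMap.rTensor (N ⊗[k] N) Coalgebra.comul)

/-- `∑ g(t₍₁₎ ⊗ n₍₁₎) g⁻¹(t₍₂₎ ⊗ n₍₂₎n'₍₁₎) g(t₍₃₎ ⊗ n'₍₂₎)` as a map `T ⊗ (N ⊗ N) → A`. -/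
noncomputable def stabRHS (g ginv : T ⊗[k] N →ₗ[k] A) : T ⊗[k] (N ⊗[k] N) →ₗ[k] A :=
  conv (g ∘ₗ LinearMap.lTensor T (dropR N N))
    (conv (ginv ∘ₗ LinearMap.lTensor T (LinearMap.mul' k N))
          (g ∘ₗ LinearMap.lTensor T (dropL N N)))

/-- `g` (with convolution inverse `ginv`) witnesses the `T`-stability of the
2-cochain `f` on `N` (with convolution inverse `finv`):
`f * (f⁻¹)ᵗ = δ'(g(t ⊗ _))`. -/
def IsStabilityWitness (μ : T ⊗[k] N →ₗ[k] N) (f finv : N ⊗[k] N →ₗ[k] A)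
    (g ginv : T ⊗[k] N →ₗ[k] A) : Prop :=
  MeasNormalized1 g ∧ (∀ t : T, g (t ⊗ₜ[k] (1 : N)) = algebraMap k A (Coalgebra.counit t))
    ∧ IsConvInv g ginv ∧ stabLHS μ f finv = stabRHS g ginv

/-- The cohomology class of the 2-cocycle `f` on `N` is `T`-stable. -/
def IsTStable (μ : T ⊗[k] N →ₗ[k] N) (f finv : N ⊗[k] N →ₗ[k] A) : Prop :=
  ∃ g ginv, IsStabilityWitness μ f finv g ginv

end MeasCohomology

section SmashStatements

variable {k : Type} [Field k]
variable {T N H A : Type} [Ring T] [Bialgebra k T] [Ring N] [Bialgebra k N]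
  [Ring H] [Bialgebra k H] [CommRing A] [Algebra k A]

/-- `n ⊗ t ↦ (n ⋊ 1)(1 ⋊ t) = n ⋊ t`. -/
noncomputable def smashMul (iN : N →ₐc[k] H) (iT : T →ₐc[k] H) : N ⊗[k] T →ₗ[k] H :=
  LinearMap.mul' k H ∘ₗ TensorProduct.map iN.toLinearMap iT.toLinearMap

/-- The restriction of a 2-cochain on `H` to `N ⊗ N`. -/
noncomputable def resNN (iN : N →ₐc[k] H) (f : H ⊗[k] H →ₗ[k] A) : N ⊗[k] N →ₗ[k] A :=
  f ∘ₗ TensorProduct.map iN.toLinearMap iN.toLinearMap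

/-- The restriction of a 2-cochain on `H` to `T ⊗ T`. -/
noncomputable def resTT (iT : T →ₐc[k] H) (f : H ⊗[k] H →ₗ[k] A) : T ⊗[k] T →ₗ[k] A :=
  f ∘ₗ TensorProduct.map iT.toLinearMap iT.toLinearMap

/-- The restriction of a 2-cochain on `H` to `T ⊗ N`. -/
noncomputable def resTN (iN : N →ₐc[k] H) (iT : T →ₐc[k] H) (f : H ⊗[k] H →ₗ[k] A) :
    T ⊗[k] N →ₗ[k] A :=
  f ∘ₗ TensorProduct.map iT.toLinearMap iN.toLinearMap

/-- `f` is trivial on `N ⊗ T`: `f(n ⊗ t) = ε(n)ε(t)1`. -/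
def TrivialOnNT (iN : N →ₐc[k] H) (iT : T →ₐc[k] H) (f : H ⊗[k] H →ₗ[k] A) : Prop :=
  ∀ (n : N) (t : T), f (iN n ⊗ₜ[k] iT t)
    = algebraMap k A (Coalgebra.counit n * Coalgebra.counit t)

/-- `f` is trivial on `T ⊗ T`. -/
def TrivialOnTT (iT : T →ₐc[k] H) (f : H ⊗[k] H →ₗ[k] A) : Prop :=
  ∀ t t' : T, f (iT t ⊗ₜ[k] iT t')
    = algebraMap k A (Coalgebra.counit t * Coalgebra.counit t')

/-- `F` is the 2-cochain `ι f : (n ⋊ t) ⊗ (n' ⋊ t') ↦ ε(n) f(t)(n') ε(t')` on `H`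
associated with a measuring 1-cochain `f`. -/
def IotaOf (iN : N →ₐc[k] H) (iT : T →ₐc[k] H) (f : T ⊗[k] N →ₗ[k] A)
    (F : H ⊗[k] H →ₗ[k] A) : Prop :=
  ∀ (n : N) (t : T) (n' : N) (t' : T),
    F ((iN n * iT t) ⊗ₜ[k] (iN n' * iT t'))
      = algebraMap k A (Coalgebra.counit n * Coalgebra.counit t') * f (t ⊗ₜ[k] n')

/-- `J` is the 3-cochain
`jf : (n⋊t) ⊗ (n'⋊t') ⊗ (n''⋊t'') ↦ ε(n)ε(n') f(t⊗t')(n'') ε(t'')` on `H`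
associated with a measuring 2-cochain `f`. -/
def JOf (iN : N →ₐc[k] H) (iT : T →ₐc[k] H) (f : (T ⊗[k] T) ⊗[k] N →ₗ[k] A)
    (J : (H ⊗[k] H) ⊗[k] H →ₗ[k] A) : Prop :=
  ∀ (n : N) (t : T) (n' : N) (t' : T) (n'' : N) (t'' : T),
    J (((iN n * iT t) ⊗ₜ[k] (iN n' * iT t')) ⊗ₜ[k] (iN n'' * iT t''))
      = algebraMap k A (Coalgebra.counit n * Coalgebra.counit n' * Coalgebra.counit t'')
          * f ((t ⊗ₜ[k] t') ⊗ₜ[k] n'')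

end SmashStatements

end SmashPaper

open TensorProduct SmashPaper


namespace SmashPaper

open WithConv

section Pullback

variable {k : Type} [Field k] {B C D A : Type} [AddCommGroup B] [Module k B] [Coalgebra k B]
  [AddCommGroup C] [Module k C] [Coalgebra k C] [AddCommGroup D] [Module k D] [Coalgebra k D]
  [CommRing A] [Algebra k A]

/-- Precomposition with a coalgebra map, as a homomorphism of convolution monoids. -/
noncomputable def pull (φ : D →ₗc[k] C) : WithConv (C →ₗ[k] A) →* WithConv (D →ₗ[k] A) where
  toFun f := toConv (f.ofConv ∘ₗ φ.toLinearMap)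
  map_one' := by
    apply WithConv.ext
    ext x
    simp [LinearMap.convOne_def]
  map_mul' f g := by
    apply WithConv.ext
    exact LinearMap.convMul_comp_coalgHom_distrib f g φ

theorem pull_pull (φ : D →ₗc[k] C) (ψ : B →ₗc[k] D) (f : WithConv (C →ₗ[k] A)) :
    pull ψ (pull φ f) = pull (φ.comp ψ) f := rfl

theorem pull_apply (φ : D →ₗc[k] C) (f : WithConv (C →ₗ[k] A)) (x : D) :
    (pull φ f).ofConv x = f.ofConv (φ x) := rfl

theorem pull_toConv {φ : D →ₗc[k] C} {p : D →ₗ[k] C} (h : φ.toLinearMap = p) (f : C →ₗ[k] A) :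
    pull φ (toConv f) = toConv (f ∘ₗ p) := by
  subst h; rfl

theorem toConv_conv (f g : C →ₗ[k] A) : toConv (conv f g) = toConv f * toConv g := rfl

theorem isConvInv_iff (f g : C →ₗ[k] A) :
    IsConvInv f g ↔ toConv f * toConv g = 1 ∧ toConv g * toConv f = 1 :=
  and_congr toConv_injective.eq_iff.symm toConv_injective.eq_iff.symm

/-- Cocommutativity transfers along a coalgebra isomorphism. -/
theorem isCocomm_of_coalgEquiv [Coalgebra.IsCocomm k C] (e : C ≃ₗc[k] D) :
    Coalgebra.IsCocomm k D where
  comm_comp_comul := by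
    apply LinearMap.ext
    intro y
    obtain ⟨x, rfl⟩ : ∃ x, e x = y := ⟨e.symm y, e.apply_symm_apply y⟩
    have h := CoalgHomClass.map_comp_comul_apply e x
    simp only [LinearMap.comp_apply, ← h, LinearEquiv.coe_coe]
    rw [← TensorProduct.map_comm, Coalgebra.comm_comul]

end Pullback

section Projections

variable (k : Type) [Field k] (C D : Type) [AddCommGroup C] [Module k C] [Coalgebra k C]
  [AddCommGroup D] [Module k D] [Coalgebra k D]

/-- `dropL` as a coalgebra map. -/
noncomputable def dropLHom : C ⊗[k] D →ₗc[k] D :=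
  (Coalgebra.TensorProduct.lid k D).toCoalgHom.comp
    (Coalgebra.TensorProduct.map (Coalgebra.counitCoalgHom k C) (CoalgHom.id k D))

/-- `dropR` as a coalgebra map. -/
noncomputable def dropRHom : C ⊗[k] D →ₗc[k] C :=
  (Coalgebra.TensorProduct.rid k k C).toCoalgHom.comp
    (Coalgebra.TensorProduct.map (CoalgHom.id k C) (Coalgebra.counitCoalgHom k D))

variable {k C D}

theorem dropLHom_toLinearMap : (dropLHom k C D).toLinearMap = dropL C D := by
  apply TensorProduct.ext'
  intro c d
  rfl

theorem dropRHom_toLinearMap : (dropRHom k C D).toLinearMap = dropR C D := by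
  apply TensorProduct.ext'
  intro c d
  rfl

theorem dropLHom_tmul (c : C) (d : D) :
    dropLHom k C D (c ⊗ₜ d) = Coalgebra.counit (R := k) c • d := rfl

theorem dropRHom_tmul (c : C) (d : D) :
    dropRHom k C D (c ⊗ₜ d) = Coalgebra.counit (R := k) d • c := rfl

end Projections

section Coboundary

variable {k : Type} [Field k] {H A : Type} [Ring H] [Bialgebra k H] [CommRing A] [Algebra k A]

/-- Multiplication `x ⊗ y ↦ xy` as a coalgebra map. -/
noncomputable abbrev mulHom (k H : Type) [Field k] [Ring H] [Bialgebra k H] :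
    H ⊗[k] H →ₗc[k] H :=
  Bialgebra.mulCoalgHom k H

theorem toConv_cobound2 (t tinv : H →ₗ[k] A) :
    toConv (cobound2 t tinv) = pull (dropLHom k H H) (toConv t) *
      (pull (mulHom k H) (toConv tinv) * pull (dropRHom k H H) (toConv t)) := by
  rw [pull_toConv (φ := dropLHom k H H) dropLHom_toLinearMap,
    pull_toConv (φ := dropRHom k H H) dropRHom_toLinearMap]
  rfl

/-- `(x ⊗ y) ⊗ z ↦ ε(x) (y ⊗ z)`, as a coalgebra map. -/
noncomputable def p23Hom (k H : Type) [Field k] [Ring H] [Bialgebra k H] :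
    (H ⊗[k] H) ⊗[k] H →ₗc[k] H ⊗[k] H :=
  (dropLHom k H (H ⊗[k] H)).comp (Coalgebra.TensorProduct.assoc k k H H H).toCoalgHom

/-- `(x ⊗ y) ⊗ z ↦ x ⊗ yz`, as a coalgebra map. -/
noncomputable def m23Hom (k H : Type) [Field k] [Ring H] [Bialgebra k H] :
    (H ⊗[k] H) ⊗[k] H →ₗc[k] H ⊗[k] H :=
  (Coalgebra.TensorProduct.map (CoalgHom.id k H) (mulHom k H)).comp
    (Coalgebra.TensorProduct.assoc k k H H H).toCoalgHom

/-- `(x ⊗ y) ⊗ z ↦ xy ⊗ z`, as a coalgebra map. -/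
noncomputable def m12Hom (k H : Type) [Field k] [Ring H] [Bialgebra k H] :
    (H ⊗[k] H) ⊗[k] H →ₗc[k] H ⊗[k] H :=
  Coalgebra.TensorProduct.map (mulHom k H) (CoalgHom.id k H)

theorem p23Hom_tmul (x y z : H) :
    p23Hom k H ((x ⊗ₜ y) ⊗ₜ z) = Coalgebra.counit (R := k) x • (y ⊗ₜ[k] z) := rfl

theorem m23Hom_tmul (x y z : H) : m23Hom k H ((x ⊗ₜ y) ⊗ₜ z) = x ⊗ₜ[k] (y * z) := rfl

theorem m12Hom_tmul (x y z : H) : m12Hom k H ((x ⊗ₜ y) ⊗ₜ z) = (x * y) ⊗ₜ[k] z := rfl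

theorem toConv_cocycle2LHS (f : H ⊗[k] H →ₗ[k] A) :
    toConv (cocycle2LHS f) =
      pull (dropRHom k (H ⊗[k] H) H) (toConv f) * pull (m12Hom k H) (toConv f) := by
  rw [pull_toConv dropRHom_toLinearMap]
  rfl

theorem toConv_cocycle2RHS (f : H ⊗[k] H →ₗ[k] A) :
    toConv (cocycle2RHS f) =
      pull (p23Hom k H) (toConv f) * pull (m23Hom k H) (toConv f) := by
  have h : (p23Hom k H).toLinearMap =
      dropL H (H ⊗[k] H) ∘ₗ (TensorProduct.assoc k H H H).toLinearMap := by
    rw [← dropLHom_toLinearMap]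
    rfl
  rw [pull_toConv h]
  rfl

theorem coalgHom_ext_threefold {C : Type} [AddCommGroup C] [Module k C] [Coalgebra k C]
    {φ ψ : (H ⊗[k] H) ⊗[k] H →ₗc[k] C}
    (h : ∀ x y z : H, φ ((x ⊗ₜ y) ⊗ₜ z) = ψ ((x ⊗ₜ y) ⊗ₜ z)) : φ = ψ :=
  CoalgHom.coe_linearMap_injective (TensorProduct.ext_threefold h)

/-- On a cocommutative bialgebra, coboundaries satisfy the 2-cocycle condition. -/
theorem cocycle2_cobound2 [Coalgebra.IsCocomm k H] {t tinv : H →ₗ[k] A} (ht : IsConvInv t tinv) :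
    cocycle2LHS (cobound2 t tinv) = cocycle2RHS (cobound2 t tinv) := by
  apply toConv_injective
  rw [toConv_cocycle2LHS, toConv_cocycle2RHS, toConv_cobound2]
  simp only [map_mul, pull_pull]
  have e₁ : (dropLHom k H H).comp (dropRHom k (H ⊗[k] H) H) =
      (dropRHom k H H).comp (p23Hom k H) :=
    coalgHom_ext_threefold fun x y z ↦ by
      simp [dropLHom_tmul, dropRHom_tmul, p23Hom_tmul, smul_smul, mul_comm]
  have e₂ : (dropLHom k H H).comp (m12Hom k H) = (dropLHom k H H).comp (p23Hom k H) :=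
    coalgHom_ext_threefold fun x y z ↦ by
      simp [dropLHom_tmul, p23Hom_tmul, m12Hom_tmul, mul_smul]
  have e₃ : (dropRHom k H H).comp (m12Hom k H) =
      (mulHom k H).comp (dropRHom k (H ⊗[k] H) H) :=
    coalgHom_ext_threefold fun x y z ↦ by
      simp [dropRHom_tmul, m12Hom_tmul]
  have e₄ : (mulHom k H).comp (m12Hom k H) = (mulHom k H).comp (m23Hom k H) :=
    coalgHom_ext_threefold fun x y z ↦ by
      simp [m23Hom_tmul, m12Hom_tmul, mul_assoc]
  have e₅ : (dropLHom k H H).comp (m23Hom k H) = (mulHom k H).comp (p23Hom k H) :=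
    coalgHom_ext_threefold fun x y z ↦ by
      simp [dropLHom_tmul, m23Hom_tmul, p23Hom_tmul]
  have e₆ : (dropRHom k H H).comp (m23Hom k H) =
      (dropRHom k H H).comp (dropRHom k (H ⊗[k] H) H) :=
    coalgHom_ext_threefold fun x y z ↦ by
      simp [dropRHom_tmul, m23Hom_tmul, smul_smul, mul_comm]
  have inv (φ : (H ⊗[k] H) ⊗[k] H →ₗc[k] H) :
      pull φ (toConv t) * pull φ (toConv tinv) = 1 := by
    rw [← map_mul, ((isConvInv_iff t tinv).1 ht).1, map_one]
  rw [e₁, e₂, e₃, e₄, e₅, e₆]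
  have h₁ := inv ((mulHom k H).comp (dropRHom k (H ⊗[k] H) H))
  have h₂ := inv ((mulHom k H).comp (p23Hom k H))
  generalize pull ((dropRHom k H H).comp (dropRHom k (H ⊗[k] H) H)) (toConv t) = u
  generalize pull ((dropRHom k H H).comp (p23Hom k H)) (toConv t) = v
  generalize pull ((dropLHom k H H).comp (p23Hom k H)) (toConv t) = w
  generalize pull ((mulHom k H).comp (m23Hom k H)) (toConv tinv) = c
  linear_combination (u * v * w * c) * h₁ - (u * v * w * c) * h₂

/-- On a cocommutative bialgebra, 2-cocycles are closed under convolution. -/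
theorem cocycle2_conv [Coalgebra.IsCocomm k H] {f g : H ⊗[k] H →ₗ[k] A}
    (hf : cocycle2LHS f = cocycle2RHS f) (hg : cocycle2LHS g = cocycle2RHS g) :
    cocycle2LHS (conv f g) = cocycle2RHS (conv f g) := by
  apply toConv_injective
  have hf' := congrArg toConv hf
  have hg' := congrArg toConv hg
  rw [toConv_cocycle2LHS, toConv_cocycle2RHS] at hf' hg' ⊢
  rw [toConv_conv, map_mul, map_mul, map_mul, map_mul, mul_mul_mul_comm, hf', hg',
    mul_mul_mul_comm]

/-- `x ↦ 1 ⊗ x` as a coalgebra map. -/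
noncomputable def oneLeft (k H : Type) [Field k] [Ring H] [Bialgebra k H] :
    H →ₗc[k] H ⊗[k] H :=
  (Coalgebra.TensorProduct.map (Bialgebra.unitBialgHom k H : k →ₗc[k] H) (CoalgHom.id k H)).comp
    (Coalgebra.TensorProduct.lid k H).symm.toCoalgHom

/-- `x ↦ x ⊗ 1` as a coalgebra map. -/
noncomputable def oneRight (k H : Type) [Field k] [Ring H] [Bialgebra k H] :
    H →ₗc[k] H ⊗[k] H :=
  (Coalgebra.TensorProduct.map (CoalgHom.id k H) (Bialgebra.unitBialgHom k H : k →ₗc[k] H)).comp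
    (Coalgebra.TensorProduct.rid k k H).symm.toCoalgHom

theorem oneLeft_apply (x : H) : oneLeft k H x = 1 ⊗ₜ[k] x :=
  congrArg (· ⊗ₜ[k] x) (map_one (algebraMap k H))

theorem oneRight_apply (x : H) : oneRight k H x = x ⊗ₜ[k] 1 :=
  congrArg (x ⊗ₜ[k] ·) (map_one (algebraMap k H))

theorem pull_eq_one_iff {C D : Type} [AddCommGroup C] [Module k C] [Coalgebra k C]
    [AddCommGroup D] [Module k D] [Coalgebra k D] (φ : D →ₗc[k] C) (f : C →ₗ[k] A) :
    pull φ (toConv f) = 1 ↔ ∀ x, f (φ x) = algebraMap k A (Coalgebra.counit x) :=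
  WithConv.ext_iff.trans LinearMap.ext_iff

theorem normalized2_iff (f : H ⊗[k] H →ₗ[k] A) :
    Normalized2 f ↔ pull (oneLeft k H) (toConv f) = 1 ∧ pull (oneRight k H) (toConv f) = 1 := by
  simp only [pull_eq_one_iff, oneLeft_apply, oneRight_apply, Normalized2, forall_and]

theorem normalized2_conv {f g : H ⊗[k] H →ₗ[k] A} (hf : Normalized2 f) (hg : Normalized2 g) :
    Normalized2 (conv f g) := by
  rw [normalized2_iff] at hf hg ⊢
  simp [toConv_conv, hf, hg]

theorem isConvInvertible_conv {f g : H ⊗[k] H →ₗ[k] A} (hf : IsConvInvertible f)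
    (hg : IsConvInvertible g) : IsConvInvertible (conv f g) := by
  obtain ⟨f', hf⟩ := hf
  obtain ⟨g', hg⟩ := hg
  rw [isConvInv_iff] at hf hg
  refine ⟨conv g' f', (isConvInv_iff _ _).2 ?_⟩
  simp only [toConv_conv]
  constructor
  · rw [mul_assoc, ← mul_assoc (toConv g), hg.1, one_mul, hf.1]
  · rw [mul_assoc, ← mul_assoc (toConv f'), hf.2, one_mul, hg.2]

theorem IsZ2.conv [Coalgebra.IsCocomm k H] {f g : H ⊗[k] H →ₗ[k] A} (hf : IsZ2 f) (hg : IsZ2 g) :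
    IsZ2 (conv f g) :=
  ⟨normalized2_conv hf.1 hg.1, isConvInvertible_conv hf.2.1 hg.2.1,
    cocycle2_conv hf.2.2 hg.2.2⟩

theorem Normalized1.of_isConvInv {t tinv : H →ₗ[k] A} (h : Normalized1 tinv)
    (ht : IsConvInv t tinv) : Normalized1 t := by
  have h₁ := LinearMap.congr_fun ht.1 1
  have h₀ : tinv 1 = 1 := h
  change t 1 = 1
  simpa [SmashPaper.conv, convOne, Algebra.TensorProduct.one_def, h₀] using h₁

theorem IsConvInv.symm {C : Type} [AddCommGroup C] [Module k C] [Coalgebra k C]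
    {f g : C →ₗ[k] A} (h : IsConvInv f g) : IsConvInv g f := ⟨h.2, h.1⟩

theorem normalized2_cobound2 {t tinv : H →ₗ[k] A} (h : Normalized1 t) (ht : IsConvInv t tinv) :
    Normalized2 (cobound2 t tinv) := by
  have h₀ : t 1 = 1 := h
  have hi := (isConvInv_iff t tinv).1 ht
  rw [normalized2_iff, toConv_cobound2]
  simp only [map_mul, pull_pull]
  have e₁ : (dropLHom k H H).comp (oneLeft k H) = CoalgHom.id k H :=
    CoalgHom.ext fun x ↦ by simp [oneLeft_apply, dropLHom_tmul]
  have e₂ : (mulHom k H).comp (oneLeft k H) = CoalgHom.id k H :=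
    CoalgHom.ext fun x ↦ by simp [oneLeft_apply]
  have e₃ : (dropRHom k H H).comp (oneRight k H) = CoalgHom.id k H :=
    CoalgHom.ext fun x ↦ by simp [oneRight_apply, dropRHom_tmul]
  have e₄ : (mulHom k H).comp (oneRight k H) = CoalgHom.id k H :=
    CoalgHom.ext fun x ↦ by simp [oneRight_apply]
  have u₁ : pull ((dropRHom k H H).comp (oneLeft k H)) (toConv t) = 1 :=
    (pull_eq_one_iff _ _).2 fun x ↦ by
      simp [oneLeft_apply, dropRHom_tmul, h₀, Algebra.algebraMap_eq_smul_one]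
  have u₂ : pull ((dropLHom k H H).comp (oneRight k H)) (toConv t) = 1 :=
    (pull_eq_one_iff _ _).2 fun x ↦ by
      simp [oneRight_apply, dropLHom_tmul, h₀, Algebra.algebraMap_eq_smul_one]
  have hid (g : WithConv (H →ₗ[k] A)) : pull (CoalgHom.id k H) g = g := rfl
  rw [e₁, e₂, e₃, e₄, u₁, u₂, hid, hid, mul_one, one_mul]
  exact hi

/-- The coboundaries of `t` and of its convolution inverse are mutually inverse. -/
theorem cobound2_isConvInv [Coalgebra.IsCocomm k H] {t tinv : H →ₗ[k] A} (ht : IsConvInv t tinv) :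
    IsConvInv (cobound2 t tinv) (cobound2 tinv t) := by
  have inv (φ : H ⊗[k] H →ₗc[k] H) : pull φ (toConv t) * pull φ (toConv tinv) = 1 := by
    rw [← map_mul, ((isConvInv_iff t tinv).1 ht).1, map_one]
  have key : toConv (cobound2 t tinv) * toConv (cobound2 tinv t) = 1 := by
    rw [toConv_cobound2, toConv_cobound2, mul_mul_mul_comm, inv, mul_mul_mul_comm, inv,
      mul_comm (pull _ (toConv tinv)), inv, one_mul, one_mul]
  exact (isConvInv_iff _ _).2 ⟨key, by rw [mul_comm, key]⟩

theorem isZ2_cobound2 [Coalgebra.IsCocomm k H] {t tinv : H →ₗ[k] A} (h : Normalized1 t)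
    (ht : IsConvInv t tinv) : IsZ2 (cobound2 t tinv) :=
  ⟨normalized2_cobound2 h ht, ⟨_, cobound2_isConvInv ht⟩, cocycle2_cobound2 ht⟩

end Coboundary

section Smash

variable {k : Type} [Field k] {T N H : Type} [Ring T] [Bialgebra k T] [Ring N] [Bialgebra k N]
  [Ring H] [Bialgebra k H]

/-- `n ⊗ t ↦ n ⊗ t` as a coalgebra map `N ⊗ T → H ⊗ H`. -/
noncomputable def inclHom (iN : N →ₐc[k] H) (iT : T →ₐc[k] H) : N ⊗[k] T →ₗc[k] H ⊗[k] H :=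
  Coalgebra.TensorProduct.map (iN : N →ₗc[k] H) (iT : T →ₗc[k] H)

theorem inclHom_tmul (iN : N →ₐc[k] H) (iT : T →ₐc[k] H) (n : N) (t : T) :
    inclHom iN iT (n ⊗ₜ t) = iN n ⊗ₜ iT t := rfl

/-- The coalgebra isomorphism `N ⊗ T ≃ H` of a smash product. -/
noncomputable def smashEquiv {μ : T ⊗[k] N →ₗ[k] N} {iN : N →ₐc[k] H} {iT : T →ₐc[k] H}
    (h : IsSmashProduct μ iN iT) : N ⊗[k] T ≃ₗc[k] H :=
  CoalgEquiv.ofBijective (f := (mulHom k H).comp (inclHom iN iT)) h.bij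

theorem smashEquiv_tmul {μ : T ⊗[k] N →ₗ[k] N} {iN : N →ₐc[k] H} {iT : T →ₐc[k] H}
    (h : IsSmashProduct μ iN iT) (n : N) (t : T) :
    smashEquiv h (n ⊗ₜ t) = iN n * iT t := rfl

theorem IsSmashProduct.isCocomm {μ : T ⊗[k] N →ₗ[k] N} {iN : N →ₐc[k] H} {iT : T →ₐc[k] H}
    (h : IsSmashProduct μ iN iT) (hT : IsCocomm k T) (hN : IsCocomm k N) :
    Coalgebra.IsCocomm k H :=
  have : Coalgebra.IsCocomm k T := ⟨hT⟩
  have : Coalgebra.IsCocomm k N := ⟨hN⟩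
  isCocomm_of_coalgEquiv (smashEquiv h)

theorem trivialOnNT_iff {A : Type} [CommRing A] [Algebra k A] (iN : N →ₐc[k] H) (iT : T →ₐc[k] H)
    (f : H ⊗[k] H →ₗ[k] A) :
    TrivialOnNT iN iT f ↔ pull (inclHom iN iT) (toConv f) = 1 := by
  constructor
  · intro h
    apply WithConv.ext
    apply TensorProduct.ext'
    intro n t
    refine (h n t).trans ?_
    simp [LinearMap.convOne_def, mul_comm]
  · intro h n t
    have := (pull_eq_one_iff _ _).1 h (n ⊗ₜ t)
    rw [inclHom_tmul] at this
    rw [this]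
    simp [mul_comm]

end Smash

end SmashPaper

/-- **Lemma (normalization of 2-cocycles on a smash product).**
Let `H = N ⋊ T` be the smash product of cocommutative Hopf algebras `N` and `T` over a
field `k`, and let the commutative `k`-algebra `A` be a trivial `H`-module.  Then every
Sweedler 2-cocycle `f : H ⊗ H → A` is cohomologous to a Sweedler 2-cocycle
`f' : H ⊗ H → A` which is trivial on `N ⊗ T`, i.e. `f'(n ⊗ t) = ε(n)ε(t)1` for all
`n ∈ N`, `t ∈ T` (identifying `n = n ⋊ 1` and `t = 1 ⋊ t`). -/
theorem smash_two_cocycle_normalizable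
    {k : Type} [Field k] {T N H A : Type}
    [Ring T] [HopfAlgebra k T] [Ring N] [HopfAlgebra k N]
    [Ring H] [HopfAlgebra k H] [CommRing A] [Algebra k A]
    (hTcc : IsCocomm k T) (hNcc : IsCocomm k N)
    (μ : T ⊗[k] N →ₗ[k] N) (iN : N →ₐc[k] H) (iT : T →ₐc[k] H)
    (hsmash : IsSmashProduct μ iN iT)
    (f : H ⊗[k] H →ₗ[k] A) (hf : IsZ2 f) :
    ∃ f' : H ⊗[k] H →ₗ[k] A,
      IsZ2 f' ∧ TrivialOnNT iN iT f' ∧ Cohomologous2 f f' := by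
  have hcc : Coalgebra.IsCocomm k H := hsmash.isCocomm hTcc hNcc
  obtain ⟨finv, hfinv⟩ := hf.2.1
  let E := (smashEquiv hsmash).symm.toCoalgHom
  have hE (n : N) (s : T) : E (iN n * iT s) = n ⊗ₜ s :=
    (smashEquiv hsmash).symm_apply_apply (n ⊗ₜ s)
  have hEN (n : N) : E (iN n) = n ⊗ₜ 1 := by simpa using hE n 1
  have hET (s : T) : E (iT s) = 1 ⊗ₜ s := by simpa using hE 1 s
  let t := (pull ((inclHom iN iT).comp E) (WithConv.toConv finv)).ofConv
  let tinv := (pull ((inclHom iN iT).comp E) (WithConv.toConv f)).ofConv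
  have htinvN (n : N) : tinv (iN n) = algebraMap k A (Coalgebra.counit n) := by
    have : tinv (iN n) = f (inclHom iN iT (E (iN n))) := rfl
    rw [this, hEN, inclHom_tmul, map_one, (hf.1 _).2, CoalgHomClass.counit_comp_apply]
  have htinvT (s : T) : tinv (iT s) = algebraMap k A (Coalgebra.counit s) := by
    have : tinv (iT s) = f (inclHom iN iT (E (iT s))) := rfl
    rw [this, hET, inclHom_tmul, map_one, (hf.1 _).1, CoalgHomClass.counit_comp_apply]
  have ht : IsConvInv t tinv := by
    rw [isConvInv_iff] at hfinv ⊢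
    simp only [t, tinv, WithConv.toConv_ofConv, ← map_mul, hfinv, map_one, and_self]
  have hn' : Normalized1 tinv := show tinv 1 = 1 by simpa using htinvN 1
  have hn : Normalized1 t := hn'.of_isConvInv ht
  refine ⟨conv f (cobound2 tinv t), hf.conv (isZ2_cobound2 hn' ht.symm), ?_,
    cobound2 t tinv, ⟨t, tinv, hn, ht, rfl⟩, ?_⟩
  · rw [trivialOnNT_iff, toConv_conv, toConv_cobound2]
    simp only [map_mul, pull_pull]
    have u₁ : pull ((dropLHom k H H).comp (inclHom iN iT)) (WithConv.toConv tinv) = 1 := by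
      apply WithConv.ext
      apply TensorProduct.ext'
      intro n s
      change tinv (dropLHom k H H (inclHom iN iT (n ⊗ₜ s))) = _
      rw [inclHom_tmul, dropLHom_tmul, map_smul, htinvT]
      simp [LinearMap.convOne_def, Algebra.smul_def, mul_comm]
    have u₂ : pull ((dropRHom k H H).comp (inclHom iN iT)) (WithConv.toConv tinv) = 1 := by
      apply WithConv.ext
      apply TensorProduct.ext'
      intro n s
      change tinv (dropRHom k H H (inclHom iN iT (n ⊗ₜ s))) = _
      rw [inclHom_tmul, dropRHom_tmul, map_smul, htinvN]
      simp [LinearMap.convOne_def, Algebra.smul_def]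
    have u₃ : pull ((mulHom k H).comp (inclHom iN iT)) (WithConv.toConv t) =
        pull (inclHom iN iT) (WithConv.toConv finv) := by
      apply WithConv.ext
      apply TensorProduct.ext'
      intro n s
      change finv (inclHom iN iT (E (iN n * iT s))) = finv (inclHom iN iT (n ⊗ₜ s))
      rw [hE]
    rw [u₁, u₂, u₃, one_mul, mul_one, ← map_mul, ((isConvInv_iff f finv).1 hfinv).1, map_one]
  · apply WithConv.toConv_injective
    rw [toConv_conv, toConv_conv, mul_assoc,
      ((isConvInv_iff _ _).1 (cobound2_isConvInv ht)).2, mul_one]
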